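/- There is an absolute constant C > 0 such that for every weighted directed hypergraph G = (V, E, w) on a finite vertex set V with n = |V| ≥ 2 vertices and every ε ∈ (0,1), there exists a weighted subhypergraph H of G with at most C · n³ · (log n) / ε² hyperarcs such that (1−ε) · κ_H(S) ≤ κ_G(S) ≤ (1+ε) · κ_H(S) for every S ⊆ V, i.e., H is an ε-cut sparsifier of G. -/

import Mathlib

open Finset

/-- The cut weight of `S` in a weighted directed hypergraph with hyperarc set `E`
and weights `w`: the total weight of hyperarcs `e = (T_e, H_e)` with
`T_e ∩ S ≠ ∅` and `H_e ∩ (V ∖ S) ≠ ∅`. -/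
noncomputable def dirCutWeight {V : Type} [Fintype V] [DecidableEq V]
    (E : Finset (Finset V × Finset V)) (w : Finset V × Finset V → ℝ)
    (S : Finset V) : ℝ :=
  ∑ e ∈ E with ((e.1 ∩ S).Nonempty ∧ (e.2 ∩ Sᶜ).Nonempty), w e

/-- The probability that independent sampling of the elements of `E`, where `e` is kept with
probability `p e`, yields exactly `A`. -/
noncomputable def sampleProb {α : Type*} [DecidableEq α] (E : Finset α) (p : α → ℝ)
    (A : Finset α) : ℝ :=
  (∏ e ∈ A, p e) * ∏ e ∈ E \ A, (1 - p e)

section Sampling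

variable {α : Type*} [DecidableEq α] {E : Finset α} {p : α → ℝ}

theorem sum_sampleProb_mul_prod (E : Finset α) (p f g : α → ℝ) :
    ∑ A ∈ E.powerset, sampleProb E p A * ((∏ e ∈ A, f e) * ∏ e ∈ E \ A, g e) =
      ∏ e ∈ E, (p e * f e + (1 - p e) * g e) := by
  rw [Finset.prod_add]
  refine Finset.sum_congr rfl fun A _ => ?_
  rw [sampleProb, Finset.prod_mul_distrib, Finset.prod_mul_distrib]
  ring

theorem sum_sampleProb (E : Finset α) (p : α → ℝ) :
    ∑ A ∈ E.powerset, sampleProb E p A = 1 := by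
  simpa using sum_sampleProb_mul_prod E p (fun _ => 1) (fun _ => 1)

theorem sampleProb_nonneg (hp0 : ∀ e ∈ E, 0 ≤ p e) (hp1 : ∀ e ∈ E, p e ≤ 1)
    {A : Finset α} (hA : A ⊆ E) : 0 ≤ sampleProb E p A :=
  mul_nonneg (Finset.prod_nonneg fun e he => hp0 e (hA he))
    (Finset.prod_nonneg fun e he => sub_nonneg.2 (hp1 e (Finset.sdiff_subset he)))

theorem exists_subset_lt_one_of_sum_sampleProb_mul_lt_one
    (hp0 : ∀ e ∈ E, 0 ≤ p e) (hp1 : ∀ e ∈ E, p e ≤ 1) {F : Finset α → ℝ}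
    (hF : ∑ A ∈ E.powerset, sampleProb E p A * F A < 1) : ∃ A ⊆ E, F A < 1 := by
  rw [← sum_sampleProb E p] at hF
  obtain ⟨A, hA, hlt⟩ := Finset.exists_lt_of_sum_lt hF
  rw [Finset.mem_powerset] at hA
  refine ⟨A, hA, ?_⟩
  by_contra! h
  exact absurd (le_mul_of_one_le_right (sampleProb_nonneg hp0 hp1 hA) h) (not_le.2 hlt)

/-- Moment generating function bound for a centred scaled Bernoulli variable. -/
theorem bernoulli_mgf_le {p y θ : ℝ} (hp0 : 0 ≤ p) (hy0 : 0 ≤ y)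
    (hy : p = 1 ∨ y ≤ 1) (hθ : |θ| ≤ 1) :
    p * Real.exp (θ * (y - p * y)) + (1 - p) * Real.exp (-(θ * (p * y))) ≤
      Real.exp (θ ^ 2 * (p * y)) := by
  rcases hy with rfl | hy1
  · have : 0 ≤ θ ^ 2 * y := by positivity
    simpa using this
  have hz : |θ * y| ≤ 1 := by
    rw [abs_mul, abs_of_nonneg hy0]
    exact mul_le_one₀ hθ hy0 hy1
  have h1 := (abs_le.1 (Real.abs_exp_sub_one_sub_id_le hz)).2
  have h2 : p * (θ * y) ^ 2 ≤ θ ^ 2 * (p * y) := by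
    have : 0 ≤ θ ^ 2 * p * y * (1 - y) := by
      have := sub_nonneg.2 hy1
      positivity
    nlinarith
  have h3 : p * Real.exp (θ * y) + (1 - p) ≤ Real.exp (θ * (p * y) + θ ^ 2 * (p * y)) := by
    refine le_trans ?_ (Real.add_one_le_exp _)
    nlinarith [mul_le_mul_of_nonneg_left h1 hp0]
  calc p * Real.exp (θ * (y - p * y)) + (1 - p) * Real.exp (-(θ * (p * y)))
      = (p * Real.exp (θ * y) + (1 - p)) * Real.exp (-(θ * (p * y))) := by
        rw [show θ * (y - p * y) = θ * y + -(θ * (p * y)) by ring, Real.exp_add]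
        ring
    _ ≤ Real.exp (θ * (p * y) + θ ^ 2 * (p * y)) * Real.exp (-(θ * (p * y))) := by gcongr
    _ = Real.exp (θ ^ 2 * (p * y)) := by
        rw [← Real.exp_add]
        congr 1
        ring

theorem sum_sampleProb_mul_exp_le {y : α → ℝ} {θ : ℝ} (hp0 : ∀ e ∈ E, 0 ≤ p e)
    (hp1 : ∀ e ∈ E, p e ≤ 1) (hy0 : ∀ e ∈ E, 0 ≤ y e) (hy : ∀ e ∈ E, p e = 1 ∨ y e ≤ 1)
    (hθ : |θ| ≤ 1) :
    ∑ A ∈ E.powerset, sampleProb E p A *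
        Real.exp (θ * (∑ e ∈ A, y e - ∑ e ∈ E, p e * y e)) ≤
      Real.exp (θ ^ 2 * ∑ e ∈ E, p e * y e) := by
  have key : ∀ A ∈ E.powerset, sampleProb E p A *
        Real.exp (θ * (∑ e ∈ A, y e - ∑ e ∈ E, p e * y e)) =
      sampleProb E p A * ((∏ e ∈ A, Real.exp (θ * (y e - p e * y e))) *
        ∏ e ∈ E \ A, Real.exp (-(θ * (p e * y e)))) := by
    intro A hA
    rw [← Real.exp_sum, ← Real.exp_sum, ← Real.exp_add,
      ← Finset.sum_sdiff (Finset.mem_powerset.1 hA), Finset.sum_neg_distrib, ← Finset.mul_sum,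
      ← Finset.mul_sum, Finset.sum_sub_distrib]
    congr 2
    ring
  rw [Finset.sum_congr rfl key, sum_sampleProb_mul_prod, Finset.mul_sum, Real.exp_sum]
  refine Finset.prod_le_prod (fun e he => ?_)
    fun e he => bernoulli_mgf_le (hp0 e he) (hy0 e he) (hy e he) hθ
  have := hp0 e he
  have := sub_nonneg.2 (hp1 e he)
  positivity

theorem sum_sampleProb_mul_two_pow_card_le (hp0 : ∀ e ∈ E, 0 ≤ p e) :
    ∑ A ∈ E.powerset, sampleProb E p A * 2 ^ A.card ≤ Real.exp (∑ e ∈ E, p e) := by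
  have h := sum_sampleProb_mul_prod E p (fun _ => 2) (fun _ => 1)
  simp only [Finset.prod_const, one_pow, mul_one] at h
  rw [h, Real.exp_sum]
  refine Finset.prod_le_prod (fun e he => ?_) fun e _ => ?_
  · linarith [hp0 e he]
  · linarith [Real.add_one_le_exp (p e)]

end Sampling

section Importance

variable {V : Type} [DecidableEq V] {E : Finset (Finset V × Finset V)}
  {w : Finset V × Finset V → ℝ}

theorem dirCutWeight_nonneg [Fintype V] (hw : ∀ e ∈ E, 0 ≤ w e) (S : Finset V) :
    0 ≤ dirCutWeight E w S :=
  Finset.sum_nonneg fun e he => hw e (Finset.mem_filter.1 he).1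

/-- The total weight of the hyperarcs with a tail containing `q.1` and a head containing `q.2`. -/
noncomputable def pairWeight (E : Finset (Finset V × Finset V)) (w : Finset V × Finset V → ℝ)
    (q : V × V) : ℝ :=
  ∑ f ∈ E with q ∈ f.1 ×ˢ f.2, w f

/-- An upper bound for the largest fraction of a cut that `e` contributes. -/
noncomputable def importance (E : Finset (Finset V × Finset V)) (w : Finset V × Finset V → ℝ)
    (e : Finset V × Finset V) : ℝ :=
  ∑ q ∈ e.1 ×ˢ e.2, w e / pairWeight E w q

theorem pairWeight_nonneg (hw : ∀ e ∈ E, 0 ≤ w e) (q : V × V) : 0 ≤ pairWeight E w q :=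
  Finset.sum_nonneg fun e he => hw e (Finset.mem_filter.1 he).1

theorem le_pairWeight (hw : ∀ e ∈ E, 0 ≤ w e) {e : Finset V × Finset V} (he : e ∈ E) {q : V × V}
    (hq : q ∈ e.1 ×ˢ e.2) : w e ≤ pairWeight E w q :=
  Finset.single_le_sum (f := w) (fun f hf => hw f (Finset.mem_filter.1 hf).1)
    (Finset.mem_filter.2 ⟨he, hq⟩)

theorem pairWeight_le_dirCutWeight [Fintype V] (hw : ∀ e ∈ E, 0 ≤ w e) {S : Finset V} {q : V × V}
    (h1 : q.1 ∈ S) (h2 : q.2 ∈ Sᶜ) : pairWeight E w q ≤ dirCutWeight E w S := by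
  refine Finset.sum_le_sum_of_subset_of_nonneg (fun f hf => ?_)
    fun f hf _ => hw f (Finset.mem_filter.1 hf).1
  obtain ⟨hf, hq⟩ := Finset.mem_filter.1 hf
  obtain ⟨hq1, hq2⟩ := Finset.mem_product.1 hq
  exact Finset.mem_filter.2
    ⟨hf, ⟨_, Finset.mem_inter.2 ⟨hq1, h1⟩⟩, ⟨_, Finset.mem_inter.2 ⟨hq2, h2⟩⟩⟩

theorem importance_nonneg (hw : ∀ e ∈ E, 0 ≤ w e) {e : Finset V × Finset V} (he : e ∈ E) :
    0 ≤ importance E w e :=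
  Finset.sum_nonneg fun q _ => div_nonneg (hw e he) (pairWeight_nonneg hw q)

theorem importance_pos (hw : ∀ e ∈ E, 0 ≤ w e) {e : Finset V × Finset V} (he : e ∈ E)
    (hne : e.1.Nonempty ∧ e.2.Nonempty) (hpos : 0 < w e) : 0 < importance E w e :=
  Finset.sum_pos (fun _ hq => div_pos hpos (hpos.trans_le (le_pairWeight hw he hq)))
    (hne.1.product hne.2)

theorem le_importance_mul_dirCutWeight [Fintype V] (hw : ∀ e ∈ E, 0 ≤ w e)
    {e : Finset V × Finset V} (he : e ∈ E) {S : Finset V} (h1 : (e.1 ∩ S).Nonempty) (h2 : (e.2 ∩ Sᶜ).Nonempty) :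
    w e ≤ importance E w e * dirCutWeight E w S := by
  obtain ⟨u, hu⟩ := h1
  obtain ⟨v, hv⟩ := h2
  rw [Finset.mem_inter] at hu hv
  have hq : (u, v) ∈ e.1 ×ˢ e.2 := Finset.mem_product.2 ⟨hu.1, hv.1⟩
  have hP := pairWeight_nonneg hw (u, v)
  calc w e = w e / pairWeight E w (u, v) * pairWeight E w (u, v) := by
        rcases hP.eq_or_lt with h | h
        · have h0 : w e = 0 := le_antisymm (h ▸ le_pairWeight hw he hq) (hw e he)
          simp [h0]
        · rw [div_mul_cancel₀ _ h.ne']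
    _ ≤ importance E w e * dirCutWeight E w S :=
        mul_le_mul
          (Finset.single_le_sum (f := fun q => w e / pairWeight E w q)
            (fun q _ => div_nonneg (hw e he) (pairWeight_nonneg hw q)) hq)
          (pairWeight_le_dirCutWeight hw hu.2 hv.2) hP (importance_nonneg hw he)

theorem sum_importance_le [Fintype V] (E : Finset (Finset V × Finset V))
    (w : Finset V × Finset V → ℝ) :
    ∑ e ∈ E, importance E w e ≤ (Fintype.card V : ℝ) ^ 2 := by
  have h : ∑ e ∈ E, importance E w e = ∑ q : V × V, pairWeight E w q / pairWeight E w q := by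
    simp_rw [importance, pairWeight, Finset.sum_div]
    exact Finset.sum_comm' (by simp)
  rw [h]
  refine (Finset.sum_le_card_nsmul _ _ 1 fun q _ => div_self_le_one _).trans ?_
  simp [sq]

end Importance

theorem exists_sparsifier_card_le {V : Type} [Fintype V] [DecidableEq V]
    {E : Finset (Finset V × Finset V)} {w : Finset V × Finset V → ℝ}
    (hE : ∀ e ∈ E, e.1.Nonempty ∧ e.2.Nonempty) (hw : ∀ e ∈ E, 0 ≤ w e)
    (hn : 1 ≤ Fintype.card V) {δ : ℝ} (hδ0 : 0 < δ) (hδ1 : δ < 1) :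
    ∃ A ⊆ E, ∃ w' : Finset V × Finset V → ℝ, (∀ e ∈ A, 0 ≤ w' e) ∧
      A.card * Real.log 2 ≤ 16 * (Fintype.card V : ℝ) ^ 3 / δ ^ 2 + Real.log 2 ∧
      ∀ S : Finset V, (1 - δ) * dirCutWeight E w S ≤ dirCutWeight A w' S ∧
        dirCutWeight A w' S ≤ (1 + δ) * dirCutWeight E w S := by
  set n := Fintype.card V with hndef
  have hn1 : (1 : ℝ) ≤ n := by exact_mod_cast hn
  set L : ℝ := 16 * n / δ ^ 2 with hL
  have hL0 : 0 < L := by positivity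
  have hLδ : δ ^ 2 * L = 16 * n := by rw [hL]; field_simp
  set p : Finset V × Finset V → ℝ := fun e => min 1 (L * importance E w e) with hp
  have hp0 : ∀ e ∈ E, 0 ≤ p e := fun e he =>
    le_min zero_le_one (mul_nonneg hL0.le (importance_nonneg hw he))
  have hp1 : ∀ e ∈ E, p e ≤ 1 := fun e _ => min_le_left _ _
  have hpw : ∀ e ∈ E, p e * (w e / p e) = w e := by
    intro e he
    rcases (hw e he).eq_or_lt with h | h
    · simp [← h]
    · have : 0 < p e :=
        lt_min one_pos (mul_pos hL0 (importance_pos hw he (hE e he) h))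
      field_simp
  have hpsum : ∑ e ∈ E, p e ≤ 16 * (n : ℝ) ^ 3 / δ ^ 2 := by
    calc ∑ e ∈ E, p e ≤ ∑ e ∈ E, L * importance E w e :=
          Finset.sum_le_sum fun e _ => min_le_right _ _
      _ = L * ∑ e ∈ E, importance E w e := by rw [Finset.mul_sum]
      _ ≤ L * (n : ℝ) ^ 2 := by gcongr; exact sum_importance_le E w
      _ = 16 * (n : ℝ) ^ 3 / δ ^ 2 := by rw [hL]; ring
  set κ : Finset V → ℝ := dirCutWeight E w with hκ
  have hκ0 : ∀ S, 0 ≤ κ S := dirCutWeight_nonneg hw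
  set w' : Finset V × Finset V → ℝ := fun e => w e / p e with hw'
  have hw'0 : ∀ e ∈ E, 0 ≤ w' e := fun e he => div_nonneg (hw e he) (hp0 e he)
  have mgf : ∀ S θ, |θ| ≤ 1 → ∑ A ∈ E.powerset, sampleProb E p A *
      Real.exp (θ * (L / κ S * (dirCutWeight A w' S - κ S))) ≤ Real.exp (θ ^ 2 * L) := by
    intro S θ hθ
    set y : Finset V × Finset V → ℝ := fun e =>
      if (e.1 ∩ S).Nonempty ∧ (e.2 ∩ Sᶜ).Nonempty then L / κ S * w' e else 0 with hy
    have hLκ : 0 ≤ L / κ S := div_nonneg hL0.le (hκ0 S)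
    have hy0 : ∀ e ∈ E, 0 ≤ y e := by
      intro e he
      simp only [hy]
      split_ifs
      · exact mul_nonneg hLκ (hw'0 e he)
      · exact le_rfl
    have hy1 : ∀ e ∈ E, p e = 1 ∨ y e ≤ 1 := by
      intro e he
      rcases le_total 1 (L * importance E w e) with h | h
      · exact Or.inl (min_eq_left h)
      right
      simp only [hy]
      split_ifs with hc
      · have hpe : p e = L * importance E w e := min_eq_right h
        have hle := le_importance_mul_dirCutWeight hw he hc.1 hc.2
        simp only [hw', hpe]
        rw [div_mul_div_comm]
        refine div_le_one_of_le₀ ?_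
          (mul_nonneg (hκ0 S) (mul_nonneg hL0.le (importance_nonneg hw he)))
        calc L * w e ≤ L * (importance E w e * κ S) := by gcongr
          _ = κ S * (L * importance E w e) := by ring
      · exact zero_le_one
    have hsum : ∀ A, ∑ e ∈ A, y e = L / κ S * dirCutWeight A w' S := by
      intro A
      rw [dirCutWeight, Finset.mul_sum, Finset.sum_filter]
    have hpy : ∑ e ∈ E, p e * y e = L / κ S * κ S := by
      rw [hκ, dirCutWeight, Finset.mul_sum, Finset.sum_filter]
      refine Finset.sum_congr rfl fun e he => ?_
      simp only [hy]
      split_ifs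
      · rw [mul_left_comm, hpw e he]
        rfl
      · simp
    have h := sum_sampleProb_mul_exp_le hp0 hp1 hy0 hy1 hθ
    simp only [hsum, hpy, ← mul_sub] at h
    refine h.trans (Real.exp_le_exp.2 ?_)
    gcongr
    rcases (hκ0 S).eq_or_lt with h0 | h0
    · simp [← h0, hL0.le]
    · rw [div_mul_cancel₀ _ h0.ne']
  set B : ℝ := Real.exp (-(δ ^ 2 * L / 2)) with hB
  set G : ℝ → Finset V → Finset (Finset V × Finset V) → ℝ := fun θ S A =>
    B * Real.exp (θ * (L / κ S * (dirCutWeight A w' S - κ S))) with hG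
  have hG0 : ∀ θ S A, 0 < G θ S A := fun θ S A => by positivity
  have hGle : ∀ θ S, θ ^ 2 = δ ^ 2 / 4 →
      ∑ A ∈ E.powerset, sampleProb E p A * G θ S A ≤ Real.exp (-(4 * n)) := by
    intro θ S hθ
    have hθ1 : |θ| ≤ 1 := abs_le_one_iff_mul_self_le_one.2 (by nlinarith)
    simp only [hG, mul_left_comm _ B]
    rw [← Finset.mul_sum]
    calc _ ≤ B * Real.exp (θ ^ 2 * L) := by gcongr; exact mgf S θ hθ1
      _ = Real.exp (-(4 * n)) := by
          rw [hB, ← Real.exp_add, hθ]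
          congr 1
          linarith
  set c : ℝ := Real.exp (-∑ e ∈ E, p e) / 2 with hc
  have hsmall : 2 ^ n * (2 * Real.exp (-(4 * n))) < (1 / 2 : ℝ) := by
    have h4 : Real.exp (-(4 * n)) ≤ (1 / 16 : ℝ) ^ n := by
      rw [show -(4 * n : ℝ) = n * (-4) by ring, Real.exp_nat_mul]
      gcongr
      have h2 : (2 : ℝ) ≤ Real.exp 1 := by linarith [Real.add_one_le_exp (1 : ℝ)]
      rw [Real.exp_neg, one_div]
      refine inv_anti₀ (by norm_num) ?_
      rw [show (4 : ℝ) = (4 : ℕ) * 1 by norm_num, Real.exp_nat_mul]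
      calc (16 : ℝ) = 2 ^ 4 := by norm_num
        _ ≤ _ := by gcongr
    calc 2 ^ n * (2 * Real.exp (-(4 * n))) ≤ 2 ^ n * (2 * (1 / 16 : ℝ) ^ n) := by gcongr
      _ = 2 * (1 / 8 : ℝ) ^ n := by
          rw [mul_left_comm, ← mul_pow]
          norm_num
      _ ≤ 2 * (1 / 8 : ℝ) ^ 1 := by
          gcongr 2 * ?_
          exact pow_le_pow_of_le_one (by norm_num) (by norm_num) hn
      _ < 1 / 2 := by norm_num
  obtain ⟨A, hAE, hA⟩ := exists_subset_lt_one_of_sum_sampleProb_mul_lt_one hp0 hp1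
    (F := fun A => c * 2 ^ A.card + ∑ S : Finset V, (G (δ / 2) S A + G (-(δ / 2)) S A)) (by
      simp only [mul_add, Finset.mul_sum, Finset.sum_add_distrib]
      rw [Finset.sum_comm (s := E.powerset) (t := Finset.univ),
        Finset.sum_comm (s := E.powerset) (t := Finset.univ)]
      have h1 : ∑ A ∈ E.powerset, sampleProb E p A * (c * 2 ^ A.card) ≤ 1 / 2 := by
        simp only [mul_left_comm _ c]
        rw [← Finset.mul_sum]
        calc _ ≤ c * Real.exp (∑ e ∈ E, p e) := by
              gcongr; exact sum_sampleProb_mul_two_pow_card_le hp0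
          _ = 1 / 2 := by
              rw [hc, div_mul_eq_mul_div, ← Real.exp_add]
              simp
      have h2 : ∀ θ, θ ^ 2 = δ ^ 2 / 4 →
          ∑ S : Finset V, ∑ A ∈ E.powerset, sampleProb E p A * G θ S A ≤
            2 ^ n * Real.exp (-(4 * n)) := by
        intro θ hθ
        refine (Finset.sum_le_card_nsmul _ _ _ fun S _ => hGle θ S hθ).trans ?_
        simp [hndef]
      linarith [h2 (δ / 2) (by ring), h2 (-(δ / 2)) (by ring)])
  have hcpos : 0 < c * 2 ^ A.card := by positivity
  have hGsum : 0 ≤ ∑ S : Finset V, (G (δ / 2) S A + G (-(δ / 2)) S A) :=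
    Finset.sum_nonneg fun S _ => (add_pos (hG0 _ _ _) (hG0 _ _ _)).le
  refine ⟨A, hAE, w', fun e he => hw'0 e (hAE he), ?_, fun S => ?_⟩
  · have h : c * 2 ^ A.card ≤ 1 := by linarith
    have h' := Real.log_nonpos hcpos.le h
    rw [hc, Real.log_mul (by positivity) (by positivity), Real.log_div (by positivity) two_ne_zero,
      Real.log_exp, Real.log_pow] at h'
    linarith
  rcases (hκ0 S).eq_or_lt with h0 | h0
  · have hz : dirCutWeight A w' S = 0 := by
      refine Finset.sum_eq_zero fun e he => ?_
      obtain ⟨heA, h1, h2⟩ := Finset.mem_filter.1 he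
      have hle := le_importance_mul_dirCutWeight hw (hAE heA) h1 h2
      have hwe : w e = 0 := by
        refine le_antisymm (hle.trans_eq ?_) (hw e (hAE heA))
        rw [show dirCutWeight E w S = 0 from h0.symm, mul_zero]
      simp [hw', hwe]
    simp [hz, ← h0]
  · have hS : G (δ / 2) S A + G (-(δ / 2)) S A < 1 := by
      have := Finset.single_le_sum (f := fun S => G (δ / 2) S A + G (-(δ / 2)) S A)
        (fun S _ => (add_pos (hG0 _ _ _) (hG0 _ _ _)).le) (Finset.mem_univ S)
      linarith
    have hexp : ∀ θ, G θ S A < 1 → θ * (dirCutWeight A w' S - κ S) < δ ^ 2 / 2 * κ S := by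
      intro θ hθ
      simp only [hG, hB] at hθ
      rw [← Real.exp_add, Real.exp_lt_one_iff] at hθ
      have h : L / κ S * (θ * (dirCutWeight A w' S - κ S)) < L / κ S * (δ ^ 2 / 2 * κ S) := by
        have : L / κ S * (δ ^ 2 / 2 * κ S) = δ ^ 2 * L / 2 := by field_simp
        linarith
      exact lt_of_mul_lt_mul_left h (by positivity)
    have hu := hexp (δ / 2) (by linarith [hG0 (-(δ / 2)) S A])
    have hl := hexp (-(δ / 2)) (by linarith [hG0 (δ / 2) S A])
    constructor <;> nlinarith

/-- Every weighted directed hypergraph on `n ≥ 2` vertices admits, for every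
`ε ∈ (0,1)`, an ε-cut sparsifier with `O(n³ log n / ε²)` hyperarcs. -/
theorem directed_hypergraph_cut_sparsifier :
    ∃ C : ℝ, 0 < C ∧
      ∀ (V : Type) [Fintype V] [DecidableEq V]
        (E : Finset (Finset V × Finset V)) (w : Finset V × Finset V → ℝ),
        (∀ e ∈ E, e.1.Nonempty ∧ e.2.Nonempty) → (∀ e ∈ E, 0 ≤ w e) →
        2 ≤ Fintype.card V →
        ∀ ε : ℝ, 0 < ε → ε < 1 →
        ∃ (E' : Finset (Finset V × Finset V)) (w' : Finset V × Finset V → ℝ),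
          E' ⊆ E ∧ (∀ e ∈ E', 0 ≤ w' e) ∧
          (E'.card : ℝ) ≤
            C * (Fintype.card V : ℝ) ^ 3 * Real.log (Fintype.card V) / ε ^ 2 ∧
          ∀ S : Finset V,
            (1 - ε) * dirCutWeight E' w' S ≤ dirCutWeight E w S ∧
            dirCutWeight E w S ≤ (1 + ε) * dirCutWeight E' w' S := by
  refine ⟨200, by norm_num, ?_⟩
  intro V _ _ E w hE hw hn ε hε0 hε1
  obtain ⟨A, hA, w', hw', hcard, hcut⟩ := exists_sparsifier_card_le hE hw (by omega)
    (half_pos hε0) (by linarith : ε / 2 < 1)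
  refine ⟨A, w', hA, hw', ?_, fun S => ?_⟩
  · have hn2 : (2 : ℝ) ≤ Fintype.card V := by exact_mod_cast hn
    set n : ℝ := (Fintype.card V : ℝ)
    have hlog : Real.log 2 ≤ Real.log n := Real.log_le_log two_pos hn2
    have hl2 := Real.log_two_gt_d9
    have hl2' := Real.log_two_lt_d9
    set M : ℝ := n ^ 3 / ε ^ 2 with hM
    have hM1 : 1 ≤ M := by
      rw [hM, one_le_div (by positivity)]
      calc ε ^ 2 ≤ 1 := pow_le_one₀ hε0.le hε1.le
        _ ≤ n ^ 3 := one_le_pow₀ (by linarith)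
    have h1 : 16 * n ^ 3 / (ε / 2) ^ 2 = 64 * M := by rw [hM]; field_simp; norm_num
    rw [h1] at hcard
    have h2 : (A.card : ℝ) ≤ 100 * M := by nlinarith
    calc (A.card : ℝ) ≤ 100 * M := h2
      _ ≤ 200 * M * Real.log n := by nlinarith
      _ = 200 * n ^ 3 * Real.log n / ε ^ 2 := by rw [hM]; ring
  · obtain ⟨hl, hu⟩ := hcut S
    have hκ := dirCutWeight_nonneg hw S
    have h1 : 0 ≤ ε * dirCutWeight E w S := by positivity
    constructor
    · nlinarith [mul_le_mul_of_nonneg_left hu (sub_nonneg.2 hε1.le), mul_nonneg hε0.le h1]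
    · nlinarith [mul_le_mul_of_nonneg_left hl (by linarith : 0 ≤ 1 + ε),
        mul_nonneg (sub_nonneg.2 hε1.le) h1]
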